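/- Let S₂ = ({1,2,3}, {∅, {1}, {2}, {3}, {1,2}, {1,3}, {2,3}}). Then the iterated handle slide ((S₂⋆{1,3})₂₃)₁₂ equals the set system ({1,2,3}, {∅, {2}, {3}, {2,3}, {1,2,3}}), this set system also equals ((S₂⋆{2,3})₁₃)₁₂, and it is not a delta-matroid (the symmetric exchange axiom fails). -/

import Mathlib

/-- A set system: a finite ground set `E` together with a collection `F`
of finite subsets (intended to be subsets of `E`). -/
structure SetSystem (α : Type*) where
  E : Finset α
  F : Set (Finset α)

namespace SetSystem

variable {α : Type*} [DecidableEq α]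

/-- A delta-matroid: a set system with nonempty feasible collection, all feasible
sets contained in the ground set, satisfying the symmetric exchange axiom. -/
def IsDeltaMatroid (D : SetSystem α) : Prop :=
  D.F.Nonempty ∧ (∀ F ∈ D.F, F ⊆ D.E) ∧
    ∀ F₁ ∈ D.F, ∀ F₂ ∈ D.F, ∀ x ∈ symmDiff F₁ F₂,
      ∃ y ∈ symmDiff F₁ F₂, symmDiff F₁ {x, y} ∈ D.F

/-- The handle slide taking `a` over `b`:
`𝓕_{ab} = 𝓕 Δ {X ∪ {a} : X ⊆ E − {a,b}, X ∪ {b} ∈ 𝓕}`. -/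
def slide (D : SetSystem α) (a b : α) : SetSystem α :=
  ⟨D.E, symmDiff D.F
    {Y : Finset α | ∃ X : Finset α, X ⊆ D.E \ {a, b} ∧ X ∪ {b} ∈ D.F ∧ Y = X ∪ {a}}⟩

/-- Iterated handle slides along a list of pairs. -/
def slides (D : SetSystem α) : List (α × α) → SetSystem α
  | [] => D
  | (a, b) :: L => slides (D.slide a b) L

/-- The twist `D ⋆ A = (E, {A Δ X : X ∈ 𝓕})`. -/
def twist (D : SetSystem α) (A : Finset α) : SetSystem α :=
  ⟨D.E, {Y : Finset α | ∃ X ∈ D.F, Y = symmDiff A X}⟩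

/-- Deletion of `e`: `D − e = (E − e, {F : F ⊆ E − e, F ∈ 𝓕})`. -/
def del (D : SetSystem α) (e : α) : SetSystem α :=
  ⟨D.E.erase e, {F : Finset α | F ⊆ D.E.erase e ∧ F ∈ D.F}⟩

/-- Contraction of `e`: `D/e = (E − e, {F : F ⊆ E − e, F ∪ {e} ∈ 𝓕})`. -/
def contr (D : SetSystem α) (e : α) : SetSystem α :=
  ⟨D.E.erase e, {F : Finset α | F ⊆ D.E.erase e ∧ F ∪ {e} ∈ D.F}⟩

/-- The set system `D(A)` of a symmetric binary matrix `A` indexed by `E`: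
feasible sets are the `W ⊆ E` whose principal submatrix `A[W]` is invertible
(the empty submatrix being invertible by convention). -/
def ofMatrix (E : Finset α) (A : Matrix E E (ZMod 2)) : SetSystem α :=
  ⟨E, {W : Finset α | ∃ h : ∀ x ∈ W, x ∈ E,
        IsUnit (Matrix.submatrix A
          (fun i : W => (⟨i.1, h i.1 i.2⟩ : E)) (fun i : W => (⟨i.1, h i.1 i.2⟩ : E)))}⟩

/-- `D` is binary: `D = D(A) ⋆ F` for some feasible `F ∈ 𝓕` and some
symmetric matrix `A` over GF(2) indexed by the ground set. -/
def IsBinary (D : SetSystem α) : Prop :=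
  ∃ F ∈ D.F, ∃ A : Matrix D.E D.E (ZMod 2),
    A.IsSymm ∧ D = (ofMatrix D.E A).twist F

/-- `IsMinor D T`: `T` is obtained from `D` by a sequence of deletions and
contractions (keeping feasible collections nonempty). -/
inductive IsMinor : SetSystem α → SetSystem α → Prop
  | refl (D : SetSystem α) : IsMinor D D
  | del {D T : SetSystem α} (e : α) (he : e ∈ D.E) (hne : (D.del e).F.Nonempty)
      (h : IsMinor (D.del e) T) : IsMinor D T
  | contr {D T : SetSystem α} (e : α) (he : e ∈ D.E) (hne : (D.contr e).F.Nonempty)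
      (h : IsMinor (D.contr e) T) : IsMinor D T

/-- Isomorphism of set systems: a bijection of ground sets carrying one
feasible collection onto the other. -/
def Isomorphic {β : Type*} [DecidableEq β] (D : SetSystem α) (D' : SetSystem β) : Prop :=
  ∃ φ : α → β, Set.InjOn φ D.E ∧ D.E.image φ = D'.E ∧
    D'.F = {Y : Finset β | ∃ X ∈ D.F, Y = X.image φ}

end SetSystem

open SetSystem

/-- The minimal non-binary delta-matroids of Bouchet–Duchamp. -/
def S₁ : SetSystem ℕ := ⟨{1, 2, 3}, {∅, {1, 2}, {1, 3}, {2, 3}, {1, 2, 3}}⟩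
def S₂ : SetSystem ℕ := ⟨{1, 2, 3}, {∅, {1}, {2}, {3}, {1, 2}, {1, 3}, {2, 3}}⟩
def S₃ : SetSystem ℕ := ⟨{1, 2, 3}, {∅, {2}, {3}, {1, 2}, {1, 3}, {1, 2, 3}}⟩
def S₄ : SetSystem ℕ := ⟨{1, 2, 3, 4}, {∅, {1, 2}, {1, 3}, {1, 4}, {2, 3}, {2, 4}, {3, 4}}⟩
def S₅ : SetSystem ℕ := ⟨{1, 2, 3, 4}, {∅, {1, 2}, {1, 4}, {2, 3}, {3, 4}, {1, 2, 3, 4}}⟩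

namespace SetSystem

variable {α : Type*} [DecidableEq α]

theorem twist_coe (E A : Finset α) (G : Finset (Finset α)) :
    (⟨E, ↑G⟩ : SetSystem α).twist A = ⟨E, ↑(G.image (symmDiff A))⟩ := by
  simp only [twist, SetSystem.mk.injEq, true_and]
  ext Y
  simp [eq_comm]

theorem slide_coe (E : Finset α) (G : Finset (Finset α)) (a b : α) :
    (⟨E, ↑G⟩ : SetSystem α).slide a b =
      ⟨E, ↑(symmDiff G
        (((E \ {a, b}).powerset.filter (fun X => X ∪ {b} ∈ G)).image (· ∪ {a})))⟩ := by
  simp only [slide, SetSystem.mk.injEq, true_and, Finset.coe_symmDiff]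
  congr 1
  ext Y
  simp [eq_comm, and_assoc]

end SetSystem

theorem S₂_eq_coe : S₂ =
    ⟨{1, 2, 3}, ↑({∅, {1}, {2}, {3}, {1, 2}, {1, 3}, {2, 3}} : Finset (Finset ℕ))⟩ := by
  simp [S₂]

/-- `((S₂⋆{1,3})₂₃)₁₂ = ({1,2,3}, {∅, {2}, {3}, {2,3}, {1,2,3}})`,
which also equals `((S₂⋆{2,3})₁₃)₁₂`, and this set system is not a delta-matroid. -/
theorem stmt_19 :
    ((S₂.twist {1, 3}).slide 2 3).slide 1 2 =
      (⟨{1, 2, 3}, {∅, {2}, {3}, {2, 3}, {1, 2, 3}}⟩ : SetSystem ℕ) ∧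
    ((S₂.twist {2, 3}).slide 1 3).slide 1 2 =
      (⟨{1, 2, 3}, {∅, {2}, {3}, {2, 3}, {1, 2, 3}}⟩ : SetSystem ℕ) ∧
    ¬ (⟨{1, 2, 3}, {∅, {2}, {3}, {2, 3}, {1, 2, 3}}⟩ : SetSystem ℕ).IsDeltaMatroid := by
  have h : (⟨{1, 2, 3}, {∅, {2}, {3}, {2, 3}, {1, 2, 3}}⟩ : SetSystem ℕ) =
      ⟨{1, 2, 3}, ↑({∅, {2}, {3}, {2, 3}, {1, 2, 3}} : Finset (Finset ℕ))⟩ := by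
    simp
  rw [h, S₂_eq_coe]
  simp only [twist_coe, slide_coe]
  refine ⟨?_, ?_, ?_⟩
  · congr 2
    decide
  · congr 2
    decide
  · rintro ⟨-, -, hex⟩
    obtain ⟨y, hy, hF⟩ := hex ∅ (by simp) {1, 2, 3} (by simp) 1 (by decide)
    rw [Finset.mem_coe] at hF
    revert y
    decide
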